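/- For every odd positive integer n and every composition α of n, the ribbon Schur Q-function 𝔯_α is irreducible as an element of the polynomial ring ℤ[q₁, q₃, q₅, …]. -/

import Mathlib

open MvPolynomial in
/-- The polynomial `q_n` (with `q_0 = 1`) in `ℤ[q₁, q₂, q₃, …]`. -/
noncomputable def QPoly (n : ℕ) : MvPolynomial ℕ ℤ := if n = 0 then 1 else MvPolynomial.X n

/-- The even Euler forms `χ_{2m} = ∑_{r+s=2m} (-1)^r q_r q_s`, `m ≥ 1`. -/
def eulerSet : Set (MvPolynomial ℕ ℤ) :=
  {p | ∃ m : ℕ, 1 ≤ m ∧ p = ∑ r ∈ Finset.range (2*m + 1), (-1) ^ r * QPoly r * QPoly (2*m - r)}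

/-- `Ω = ℤ[q₁, q₂, q₃, …]/(even Euler relations)`, the algebra of Schur Q-functions. -/
abbrev Omega : Type := MvPolynomial ℕ ℤ ⧸ Ideal.span eulerSet

/-- The generators `q_n` of `Ω` (with `q 0 = 1`). -/
noncomputable def q (n : ℕ) : Omega := Ideal.Quotient.mk (Ideal.span eulerSet) (QPoly n)

/-- A composition: a nonempty list of positive integers. -/
def IsComposition (α : List ℕ) : Prop := α ≠ [] ∧ ∀ a ∈ α, 0 < a

/-- `α ⊙ β`: add the last part of `α` to the first part of `β`. -/
def compNcat (α β : List ℕ) : List ℕ :=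
  match α.reverse with
  | [] => β
  | a :: as =>
    match β with
    | [] => α
    | b :: bs => as.reverse ++ (a + b) :: bs

/-- The list of all coarsenings of a composition (obtained by adding adjacent parts). -/
def coarsenings : List ℕ → List (List ℕ)
  | [] => [[]]
  | [a] => [[a]]
  | a :: b :: t => ((coarsenings (b :: t)).map (a :: ·)) ++ coarsenings ((a + b) :: t)
  termination_by α => α.length

/-- `q_{λ(β)} = q_{β₁} ⋯ q_{β_m}`. -/
noncomputable def qProd (β : List ℕ) : Omega := (β.map q).prod

/-- The ribbon Schur Q-function `𝔯_α = (-1)^{ℓ(α)} ∑_{β ⪰ α} (-1)^{ℓ(β)} q_{λ(β)}`. -/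
noncomputable def ribbonQ (α : List ℕ) : Omega :=
  (-1) ^ α.length * ((coarsenings α).map (fun β => (-1 : Omega) ^ β.length * qProd β)).sum

/-- Generators of the ideal vanish in the quotient: the Euler relation. -/
lemma omega_euler (m : ℕ) (hm : 1 ≤ m) :
    ∑ r ∈ Finset.range (2*m + 1), (-1 : Omega) ^ r * q r * q (2*m - r) = 0 := by
  have h : Ideal.Quotient.mk (Ideal.span eulerSet)
      (∑ r ∈ Finset.range (2*m + 1), (-1) ^ r * QPoly r * QPoly (2*m - r)) = 0 :=
    Ideal.Quotient.eq_zero_iff_mem.2 (Ideal.subset_span ⟨m, hm, rfl⟩)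
  simpa [map_sum, q] using h

/-- The class of the variable with index zero. -/
noncomputable def xZero : Omega := Ideal.Quotient.mk (Ideal.span eulerSet) (MvPolynomial.X 0)

lemma q_zero : q 0 = 1 := by simp [q, QPoly]

lemma omega_induction {P : Omega → Prop} (hint : ∀ a : ℤ, P (a : Omega)) (h0 : P xZero)
    (hq : ∀ n, 0 < n → P (q n)) (hadd : ∀ a b, P a → P b → P (a + b))
    (hmul : ∀ a b, P a → P b → P (a * b)) (x : Omega) : P x := by
  obtain ⟨p, rfl⟩ := Ideal.Quotient.mk_surjective x
  induction p using MvPolynomial.induction_on with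
  | C a =>
    have := hint a
    have e : (MvPolynomial.C a : MvPolynomial ℕ ℤ) = (a : MvPolynomial ℕ ℤ) := by simp
    rw [e, map_intCast]
    exact this
  | add p q hp hq' => rw [map_add]; exact hadd _ _ hp hq'
  | mul_X p n hp =>
    rw [map_mul]
    refine hmul _ _ hp ?_
    rcases Nat.eq_zero_or_pos n with rfl | hn
    · exact h0
    · have := hq n hn
      simpa [q, QPoly, hn.ne'] using this

lemma exists_hom {A : Type} [CommRing A] (a0 : A) (Q : ℕ → A) (h0 : Q 0 = 1)
    (hQ : ∀ m, 1 ≤ m → ∑ r ∈ Finset.range (2*m + 1), (-1 : A) ^ r * Q r * Q (2*m - r) = 0) :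
    ∃ φ : Omega →+* A, φ xZero = a0 ∧ ∀ n, φ (q n) = Q n := by
  set F : MvPolynomial ℕ ℤ →+* A :=
    MvPolynomial.eval₂Hom (Int.castRingHom A) (fun n => if n = 0 then a0 else Q n) with hF
  have hFQ : ∀ n, F (QPoly n) = Q n := by
    intro n
    by_cases hn : n = 0
    · subst hn; simp [QPoly, h0]
    · simp [QPoly, hn, hF]
  have hI : ∀ p ∈ Ideal.span eulerSet, F p = 0 := by
    intro p hp
    have : Ideal.span eulerSet ≤ RingHom.ker F := by
      rw [Ideal.span_le]
      rintro _ ⟨m, hm, rfl⟩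
      simp only [SetLike.mem_coe, RingHom.mem_ker, map_sum, map_mul, map_pow, map_neg, map_one, hFQ]
      exact hQ m hm
    exact this hp
  refine ⟨Ideal.Quotient.lift _ F hI, ?_, ?_⟩
  · simp [xZero, hF]
  · intro n; simp [q, hFQ]

/-- Images of the `q_n` in the rational polynomial ring; `X j` stands for `q_{2j-1}`. -/
noncomputable def ratQ (n : ℕ) : MvPolynomial ℕ ℚ :=
  if n = 0 then 1
  else if n % 2 = 1 then MvPolynomial.X ((n + 1) / 2)
  else MvPolynomial.C (-1/2) * ∑ r : Fin (n - 1), (-1) ^ (r.1 + 1) * ratQ (r.1 + 1) * ratQ (n - (r.1 + 1))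
  termination_by n
  decreasing_by
    all_goals have := r.2; omega

lemma ratQ_zero : ratQ 0 = 1 := by rw [ratQ]; simp

lemma ratQ_odd (n : ℕ) (h : n % 2 = 1) : ratQ n = MvPolynomial.X ((n + 1) / 2) := by
  rw [ratQ, if_neg (by omega), if_pos h]

lemma ratQ_even (n : ℕ) (h : n % 2 = 0) (h0 : 0 < n) : ratQ n = MvPolynomial.C (-1/2) *
    ∑ r ∈ Finset.range (n - 1), (-1) ^ (r + 1) * ratQ (r + 1) * ratQ (n - (r + 1)) := by
  rw [ratQ, if_neg (by omega), if_neg (by omega),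
    Finset.sum_range (fun r => (-1) ^ (r + 1) * ratQ (r + 1) * ratQ (n - (r + 1)))]

lemma euler_split {A : Type} [CommRing A] (Q : ℕ → A) (h0 : Q 0 = 1) (m : ℕ) (hm : 1 ≤ m) :
    ∑ r ∈ Finset.range (2*m + 1), (-1 : A) ^ r * Q r * Q (2*m - r) =
    2 * Q (2*m) +
      ∑ r ∈ Finset.range (2*m - 1), (-1) ^ (r + 1) * Q (r + 1) * Q (2*m - (r + 1)) := by
  obtain ⟨k, rfl⟩ : ∃ k, m = k + 1 := ⟨m - 1, by omega⟩
  rw [Finset.sum_range_succ, show 2 * (k+1) = (2*(k+1) - 1) + 1 by omega, Finset.sum_range_succ']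
  have : (-1 : A) ^ (2 * (k + 1) - 1 + 1) = 1 := by
    rw [show 2 * (k + 1) - 1 + 1 = 2 * (k+1) by omega]; simp
  rw [this]
  simp only [h0, pow_zero, Nat.sub_self, Nat.sub_zero, Nat.add_sub_cancel]
  ring

lemma ratQ_euler (m : ℕ) (hm : 1 ≤ m) :
    ∑ r ∈ Finset.range (2*m + 1), (-1 : MvPolynomial ℕ ℚ) ^ r * ratQ r * ratQ (2*m - r) = 0 := by
  rw [euler_split ratQ ratQ_zero m hm, ratQ_even (2*m) (by omega) (by omega)]
  have : (2 : MvPolynomial ℕ ℚ) * MvPolynomial.C (-1/2) = -1 := by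
    rw [show (2 : MvPolynomial ℕ ℚ) = MvPolynomial.C 2 from (map_ofNat MvPolynomial.C 2).symm, ← MvPolynomial.C_mul]
    norm_num
  rw [← mul_assoc, this]
  ring

lemma ratQ_const (n : ℕ) (hn : 0 < n) : MvPolynomial.constantCoeff (ratQ n) = 0 := by
  induction n using Nat.strong_induction_on with
  | _ n ih =>
    by_cases h : n % 2 = 1
    · rw [ratQ_odd n h]; simp
    · rw [ratQ_even n (by omega) hn, map_mul, map_sum, Finset.sum_eq_zero, mul_zero]
      intro r hr
      rw [Finset.mem_range] at hr
      rw [map_mul, map_mul, ih (r + 1) (by omega) (by omega)]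
      simp

lemma ratQ_supp (N n : ℕ) (hn : n + 1 < 2 * N) :
    ratQ n ∈ MvPolynomial.supported ℚ {j : ℕ | j < N} := by
  induction n using Nat.strong_induction_on with
  | _ n ih =>
    by_cases h : n % 2 = 1
    · rw [ratQ_odd n h, MvPolynomial.X_mem_supported]
      simp only [Set.mem_ofPred_eq]; omega
    · rcases Nat.eq_zero_or_pos n with rfl | h0
      · rw [ratQ_zero]; exact one_mem _
      rw [ratQ_even n (by omega) h0]
      refine mul_mem (Subalgebra.algebraMap_mem _ _) (sum_mem fun r hr => ?_)
      rw [Finset.mem_range] at hr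
      exact mul_mem (mul_mem (pow_mem (neg_mem (one_mem _)) _) (ih _ (by omega) (by omega)))
        (ih _ (by omega) (by omega))

/-- The odd subalgebra. -/
noncomputable def iotaHom : MvPolynomial ℕ ℤ →+* Omega :=
  MvPolynomial.eval₂Hom (Int.castRingHom Omega) (fun j => if j = 0 then xZero else q (2*j - 1))

lemma exists_two_pow (x : Omega) : ∃ k : ℕ, ∃ p, (2 : Omega) ^ k * x = iotaHom p := by
  have hadd : ∀ a b : Omega, (∃ k : ℕ, ∃ p, (2 : Omega) ^ k * a = iotaHom p) →
      (∃ k : ℕ, ∃ p, (2 : Omega) ^ k * b = iotaHom p) →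
      ∃ k : ℕ, ∃ p, (2 : Omega) ^ k * (a + b) = iotaHom p := by
    rintro a b ⟨k, p, h⟩ ⟨l, r, h'⟩
    refine ⟨k + l, 2 ^ l * p + 2 ^ k * r, ?_⟩
    rw [map_add, map_mul, map_mul, ← h, ← h', map_pow, map_pow, map_ofNat]
    ring
  have hmul : ∀ a b : Omega, (∃ k : ℕ, ∃ p, (2 : Omega) ^ k * a = iotaHom p) →
      (∃ k : ℕ, ∃ p, (2 : Omega) ^ k * b = iotaHom p) →
      ∃ k : ℕ, ∃ p, (2 : Omega) ^ k * (a * b) = iotaHom p := by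
    rintro a b ⟨k, p, h⟩ ⟨l, r, h'⟩
    refine ⟨k + l, p * r, ?_⟩
    rw [map_mul, ← h, ← h']
    ring
  have hint : ∀ a : ℤ, ∃ k : ℕ, ∃ p, (2 : Omega) ^ k * (a : Omega) = iotaHom p :=
    fun a => ⟨0, a, by simp⟩
  refine omega_induction (P := fun x => ∃ k : ℕ, ∃ p, (2 : Omega) ^ k * x = iotaHom p)
    hint ⟨0, MvPolynomial.X 0, by simp [iotaHom]⟩ ?_ hadd hmul x
  intro n hn
  induction n using Nat.strong_induction_on with
  | _ n ih =>
    by_cases h : n % 2 = 1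
    · refine ⟨0, MvPolynomial.X ((n+1)/2), ?_⟩
      simp only [iotaHom, MvPolynomial.coe_eval₂Hom, MvPolynomial.eval₂_X]
      rw [if_neg (by omega), show 2 * ((n+1)/2) - 1 = n by omega]
      simp
    · obtain ⟨m, rfl⟩ : ∃ m, n = 2 * m := ⟨n / 2, by omega⟩
      have he := omega_euler m (by omega)
      rw [euler_split q q_zero m (by omega)] at he
      have hs : ∃ k : ℕ, ∃ p, (2 : Omega) ^ k * (∑ r ∈ Finset.range (2*m - 1),
          (-1) ^ (r + 1) * q (r + 1) * q (2*m - (r + 1))) = iotaHom p := by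
        refine Finset.sum_induction _ (fun x => ∃ k : ℕ, ∃ p, (2 : Omega) ^ k * x = iotaHom p)
          hadd ⟨0, 0, by simp⟩ ?_
        intro r hr
        rw [Finset.mem_range] at hr
        refine hmul _ _ (hmul _ _ ⟨0, (-1) ^ (r+1), by simp⟩ (ih _ (by omega) (by omega)))
          (ih _ (by omega) (by omega))
      obtain ⟨k, p, hp⟩ := hs
      refine ⟨k + 1, -p, ?_⟩
      rw [map_neg, ← hp]
      linear_combination (2 : Omega) ^ k * he

lemma torsion_of_ker (φ : Omega →+* MvPolynomial ℕ ℚ) (h0 : φ xZero = MvPolynomial.X 0)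
    (hq : ∀ n, φ (q n) = ratQ n) (x : Omega) (hx : φ x = 0) :
    ∃ k : ℕ, (2 : Omega) ^ k * x = 0 := by
  obtain ⟨k, p, h⟩ := exists_two_pow x
  have hc : φ.comp iotaHom = MvPolynomial.map (Int.castRingHom ℚ) := by
    apply MvPolynomial.ringHom_ext
    · intro r; simp [iotaHom]
    · intro j
      by_cases hj : j = 0
      · subst hj; simp [iotaHom, h0]
      · simp only [iotaHom, RingHom.comp_apply, MvPolynomial.coe_eval₂Hom, MvPolynomial.eval₂_X,
          if_neg hj, hq, MvPolynomial.map_X]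
        rw [ratQ_odd _ (by omega)]
        congr 1; omega
  have h1 : φ (iotaHom p) = 0 := by rw [← h, map_mul, hx, mul_zero]
  have h2 : MvPolynomial.map (Int.castRingHom ℚ) p = 0 := by
    rw [← hc]; exact h1
  have h3 : p = 0 := by
    apply MvPolynomial.map_injective (Int.castRingHom ℚ) Int.cast_injective
    rw [h2, map_zero]
  exact ⟨k, by rw [h, h3, map_zero]⟩

lemma zero_euler {A : Type} [CommRing A] (m : ℕ) (hm : 1 ≤ m) :
    ∑ r ∈ Finset.range (2*m + 1), (-1 : A) ^ r * (if r = 0 then 1 else 0) *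
      (if 2*m - r = 0 then 1 else 0) = 0 := by
  apply Finset.sum_eq_zero
  intro r _
  split_ifs <;> first | omega | simp

lemma neg_one_pow_add_two_mul {A : Type} [CommRing A] (r s : ℕ) :
    (-1 : A) ^ (r + 2 * s) = (-1) ^ r := by
  rw [pow_add, pow_mul]; simp

lemma q_sq (m : ℕ) (hm : 1 ≤ m) : ∃ y, q m ^ 2 = 2 * y := by
  have he := omega_euler m hm
  obtain ⟨k, rfl⟩ : ∃ k, m = k + 1 := ⟨m - 1, by omega⟩
  rw [show 2 * (k+1) + 1 = (k + 2) + (k + 1) by omega, Finset.sum_range_add,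
    Finset.sum_range_succ] at he
  have hrefl : ∑ x ∈ Finset.range (k + 1), (-1 : Omega) ^ (k + 2 + x) * q (k + 2 + x) *
      q (2 * (k + 1) - (k + 2 + x)) =
      ∑ r ∈ Finset.range (k + 1), (-1 : Omega) ^ r * q r * q (2*(k+1) - r) := by
    rw [← Finset.sum_range_reflect]
    apply Finset.sum_congr rfl
    intro r hr
    rw [Finset.mem_range] at hr
    rw [show k + 2 + (k + 1 - 1 - r) = 2 * (k+1) - r by omega,
      show 2 * (k+1) - (2 * (k+1) - r) = r by omega]
    have : (-1 : Omega) ^ (2 * (k+1) - r) = (-1) ^ r := by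
      rw [show 2 * (k+1) - r = r + 2 * (k + 1 - r) by omega]
      exact neg_one_pow_add_two_mul r (k + 1 - r)
    rw [this]; ring
  rw [hrefl, show 2 * (k+1) - (k+1) = k + 1 by omega] at he
  set S := ∑ r ∈ Finset.range (k + 1), (-1 : Omega) ^ r * q r * q (2*(k+1) - r)
  rcases neg_one_pow_eq_or Omega (k+1) with h | h <;> rw [h] at he
  · exact ⟨-S, by linear_combination he⟩
  · exact ⟨S, by linear_combination -he⟩

lemma nilpotent_of_torsion (x : Omega) (k : ℕ) (hx : (2 : Omega) ^ k * x = 0) :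
    IsNilpotent x := by
  obtain ⟨ε, hε0, hεq⟩ := exists_hom (A := Polynomial ℤ) Polynomial.X
    (fun n => if n = 0 then 1 else 0) (by simp) zero_euler
  set ι : Polynomial ℤ →+* Omega := Polynomial.eval₂RingHom (Int.castRingHom Omega) xZero with hι
  have key : ∃ y, x ^ 2 = ι (ε x) ^ 2 + 2 * y := by
    refine omega_induction (P := fun x => ∃ y, x ^ 2 = ι (ε x) ^ 2 + 2 * y) ?_ ?_ ?_ ?_ ?_ x
    · intro a; exact ⟨0, by simp⟩
    · exact ⟨0, by simp [hε0, hι]⟩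
    · intro n hn
      obtain ⟨y, hy⟩ := q_sq n hn
      exact ⟨y, by simp [hεq, hn.ne', hy]⟩
    · rintro a b ⟨y, hy⟩ ⟨z, hz⟩
      refine ⟨y + z + a * b - ι (ε a) * ι (ε b), ?_⟩
      rw [map_add, map_add]
      linear_combination hy + hz
    · rintro a b ⟨y, hy⟩ ⟨z, hz⟩
      refine ⟨y * b ^ 2 + ι (ε a) ^ 2 * z, ?_⟩
      rw [map_mul, map_mul]
      linear_combination b ^ 2 * hy + ι (ε a) ^ 2 * hz
  have hz : ε x = 0 := by
    have := congrArg ε hx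
    rw [map_mul, map_zero, map_pow, map_ofNat] at this
    exact (mul_eq_zero.1 this).resolve_left (pow_ne_zero _ two_ne_zero)
  obtain ⟨y, hy⟩ := key
  rw [hz, map_zero] at hy
  refine ⟨2 * k + 1, ?_⟩
  rw [pow_succ, pow_mul, hy]
  linear_combination y ^ k * hx

lemma coarsenings_spec (α : List ℕ) (h : α ≠ []) (hp : ∀ a ∈ α, 0 < a) :
    ∃ L, coarsenings α = L ++ [[α.sum]] ∧
      ∀ β ∈ L, 2 ≤ β.length ∧ (∀ b ∈ β, 0 < b) ∧ β.sum = α.sum := by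
  induction hl : α.length using Nat.strong_induction_on generalizing α with
  | _ l ih =>
    match α, h, hp, hl with
    | [a], _, _, _ => exact ⟨[], by simp [coarsenings], by simp⟩
    | a :: b :: t, _, hp, hl =>
      have hl' : t.length + 1 + 1 = l := by simpa using hl
      have ha : 0 < a := hp a (by simp)
      obtain ⟨L1, h1, h1'⟩ := ih (t.length + 1) (by omega) (b :: t) (by simp)
        (fun x hx => hp x (List.mem_cons_of_mem _ hx)) (by simp)
      obtain ⟨L2, h2, h2'⟩ := ih (t.length + 1) (by omega) ((a + b) :: t) (by simp)
        (by
          intro x hx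
          rcases List.mem_cons.1 hx with rfl | hx
          · omega
          · exact hp x (by simp [hx])) (by simp)
      have hb : 0 < b := hp b (by simp)
      refine ⟨(L1 ++ [[(b :: t).sum]]).map (a :: ·) ++ L2, ?_, ?_⟩
      · rw [coarsenings, h1, h2]
        simp [add_assoc]
      · intro β hβ
        rw [List.mem_append] at hβ
        rcases hβ with hβ | hβ
        · rw [List.mem_map] at hβ
          obtain ⟨γ, hγ, rfl⟩ := hβ
          rw [List.mem_append] at hγ
          rcases hγ with hγ | hγ
          · obtain ⟨g1, g2, g3⟩ := h1' γ hγ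
            refine ⟨by simp; omega, ?_, by simp [g3]⟩
            intro c hc
            rcases List.mem_cons.1 hc with rfl | hc
            · exact ha
            · exact g2 c hc
          · rw [List.mem_singleton] at hγ
            subst hγ
            refine ⟨by simp, ?_, by simp⟩
            intro c hc
            simp at hc
            omega
        · obtain ⟨g1, g2, g3⟩ := h2' β hβ
          exact ⟨g1, g2, by rw [g3]; simp [add_assoc]⟩

lemma ribbonQ_decomp (n : ℕ) (α : List ℕ) (hα : IsComposition α) (hsum : α.sum = n) :
    ∃ L : List (List ℕ), (∀ β ∈ L, ∃ b c t, β = b :: c :: t ∧ ∀ x ∈ β, 0 < x ∧ x < n) ∧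
      ribbonQ α = (-1) ^ α.length *
        ((L.map (fun β => (-1 : Omega) ^ β.length * qProd β)).sum - q n) := by
  obtain ⟨L, h1, h2⟩ := coarsenings_spec α hα.1 hα.2
  refine ⟨L, ?_, ?_⟩
  · intro β hβ
    obtain ⟨g1, g2, g3⟩ := h2 β hβ
    match β, g1 with
    | b :: c :: t, _ =>
      refine ⟨b, c, t, rfl, fun x hx => ⟨g2 x hx, ?_⟩⟩
      have hb := g2 b (by simp)
      have hc := g2 c (by simp)
      rw [hsum] at g3
      simp only [List.sum_cons] at g3
      simp only [List.mem_cons] at hx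
      rcases hx with rfl | rfl | hx
      · omega
      · omega
      · have := List.le_sum_of_mem hx
        omega
  · rw [ribbonQ, h1, hsum]
    simp [qProd, sub_eq_add_neg]
    ring

/-- for every odd `n` and every composition `α` of `n`, the ribbon Schur
Q-function `𝔯_α` is irreducible as an element of `Ω ≅ ℤ[q₁, q₃, q₅, …]`. -/
theorem ribbonQ_irreducible_of_odd (n : ℕ) (hn : Odd n)
    (α : List ℕ) (hα : IsComposition α) (hsum : α.sum = n) :
    Irreducible (ribbonQ α) := by
  obtain ⟨L, hL, hr⟩ := ribbonQ_decomp n α hα hsum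
  have hodd : n % 2 = 1 := Nat.odd_iff.1 hn
  obtain ⟨φ, φ0, φq⟩ := exists_hom (MvPolynomial.X 0 : MvPolynomial ℕ ℚ) ratQ ratQ_zero ratQ_euler
  obtain ⟨η, η0, ηq⟩ := exists_hom (0 : ℤ) (fun n => if n = 0 then 1 else 0) (by simp) zero_euler
  obtain ⟨δ, δ0, δq⟩ := exists_hom (0 : DualNumber ℤ)
    (fun i => if i = 0 then 1 else if i = n then DualNumber.eps else 0) (by simp) (by
      intro m hm
      apply Finset.sum_eq_zero
      intro r hr
      rw [Finset.mem_range] at hr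
      split_ifs <;> first | omega | simp [mul_assoc, DualNumber.eps_mul_eps])
  have hδ : δ (ribbonQ α) = (-1) ^ α.length * (- DualNumber.eps) := by
    have hz : δ ((L.map (fun β => (-1 : Omega) ^ β.length * qProd β)).sum) = 0 := by
      rw [map_list_sum, List.map_map]
      apply List.sum_eq_zero
      intro y hy
      obtain ⟨β, hβ, rfl⟩ := List.mem_map.1 hy
      obtain ⟨b, c, t, rfl, hx⟩ := hL β hβ
      have hb := hx b (by simp)
      simp [qProd, δq, hb.1.ne', hb.2.ne]
    rw [hr, map_mul, map_sub, hz, δq, if_neg (by omega), if_pos rfl]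
    simp
  have hφ : Irreducible (φ (ribbonQ α)) := by
    set N := (n + 1) / 2 with hN
    have hmem : φ ((L.map (fun β => (-1 : Omega) ^ β.length * qProd β)).sum) ∈
        MvPolynomial.supported ℚ {j : ℕ | j < N} := by
      rw [map_list_sum, List.map_map]
      apply list_sum_mem
      intro y hy
      obtain ⟨β, hβ, rfl⟩ := List.mem_map.1 hy
      obtain ⟨b, c, t, hβe, hx⟩ := hL β hβ
      simp only [Function.comp_apply, map_mul, map_pow, map_neg, map_one, qProd]
      refine mul_mem (pow_mem (neg_mem (one_mem _)) _) ?_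
      rw [map_list_prod, List.map_map]
      apply list_prod_mem
      intro z hz
      obtain ⟨i, hi, rfl⟩ := List.mem_map.1 hz
      simp only [Function.comp_apply, φq]
      exact ratQ_supp N i (by have := hx i hi; omega)
    set R := φ ((L.map (fun β => (-1 : Omega) ^ β.length * qProd β)).sum) with hR
    have hirr : Irreducible (1 * MvPolynomial.X N + -R) := by
      apply MvPolynomial.irreducible_mul_X_add
      · exact one_ne_zero
      · simp
      · rw [MvPolynomial.vars_neg]
        intro hmemN
        have := MvPolynomial.mem_supported.1 hmem hmemN
        simp at this
      · exact isRelPrime_one_left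
    have e : φ (ribbonQ α) = (-1) ^ (α.length + 1) * (1 * MvPolynomial.X N + -R) := by
      rw [hr, map_mul, map_sub, ← hR, φq, ratQ_odd n hodd, map_pow, map_neg, map_one]
      ring
    rw [e]
    exact (irreducible_isUnit_mul (IsUnit.pow _ isUnit_one.neg)).2 hirr
  have hηφ : ∀ x, ((η x : ℤ) : ℚ) = MvPolynomial.constantCoeff (φ x) := by
    intro x
    refine omega_induction (P := fun x => ((η x : ℤ) : ℚ) = MvPolynomial.constantCoeff (φ x))
      ?_ ?_ ?_ ?_ ?_ x
    · intro a; simp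
    · simp [η0, φ0]
    · intro i hi; rw [φq, ηq, ratQ_const i hi]; simp [hi.ne']
    · intro a b ha hb; simp [ha, hb]
    · intro a b ha hb; simp [ha, hb]
  have main : ∀ f g : Omega, ribbonQ α = f * g → IsUnit (φ f) → IsUnit f := by
    intro f g hfg hu
    obtain ⟨c, -, hc⟩ := MvPolynomial.isUnit_iff_eq_C_of_isReduced.1 hu
    have hc' : ((η f : ℤ) : ℚ) = c := by rw [hηφ, hc]; simp
    obtain ⟨z, hz⟩ : ∃ z, z = f - ((η f : ℤ) : Omega) := ⟨_, rfl⟩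
    have hφz : φ z = 0 := by
      rw [hz, map_sub, map_intCast, hc, ← hc']; simp
    obtain ⟨k, hk⟩ := torsion_of_ker φ φ0 φq z hφz
    have hnil := nilpotent_of_torsion z k hk
    have hδz : δ z = 0 := by
      have h := congrArg δ hk
      rw [map_mul, map_zero, map_pow, map_ofNat] at h
      have h2 : (((2 ^ k : ℤ)) : DualNumber ℤ) * δ z = 0 := by push_cast; exact h
      rw [← zsmul_eq_mul] at h2
      have h2k : (2 : ℤ) ^ k ≠ 0 := pow_ne_zero _ two_ne_zero
      generalize (2 : ℤ) ^ k = K at h2 h2k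
      apply TrivSqZeroExt.ext
      · have := congrArg TrivSqZeroExt.fst h2
        simpa [h2k] using this
      · have := congrArg TrivSqZeroExt.snd h2
        simpa [h2k] using this
    have hf : f = z + ((η f : ℤ) : Omega) := by rw [hz]; ring
    have hδf : δ f = ((η f : ℤ) : DualNumber ℤ) := by
      conv_lhs => rw [hf]
      rw [map_add, hδz, map_intCast, zero_add]
    have h3 : (-1) ^ α.length * (- DualNumber.eps) = ((η f : ℤ) : DualNumber ℤ) * δ g := by
      rw [← hδ, hfg, map_mul, hδf]
    have h4 : IsUnit (η f) := by
      rw [← zsmul_eq_mul] at h3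
      have h5 := congrArg TrivSqZeroExt.snd h3
      rcases neg_one_pow_eq_or (DualNumber ℤ) α.length with h | h <;> rw [h] at h5
      · exact IsUnit.of_mul_eq_one (-(δ g).snd) (by simp at h5; linarith)
      · exact IsUnit.of_mul_eq_one ((δ g).snd) (by simp at h5; linarith)
    rw [hf, add_comm]
    have h6 : IsUnit (((η f : ℤ) : Omega)) := h4.map (Int.castRingHom Omega)
    exact hnil.isUnit_add_left_of_commute h6 (Commute.all _ _)
  refine ⟨fun h => hφ.not_isUnit (h.map φ), ?_⟩
  intro f g hfg
  rcases hφ.isUnit_or_isUnit (show φ (ribbonQ α) = φ f * φ g by rw [hfg, map_mul]) with h | h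
  · exact Or.inl (main f g hfg h)
  · exact Or.inr (main g f (by rw [hfg, mul_comm]) h)
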